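/- Let Q be a Dirac potential on [0,b] with continuously differentiable entries and let K be a continuously differentiable transmutation kernel for Q, with Fourier–Legendre coefficients K_n. Set θ_n(x) := xⁿ·K_n(x) for n ≥ 0, and θ_{−1}(x) := −K₀(x)/x. Then θ_n(0) = 0 for all n ≥ 1, and for every integer n ≥ 1 and every x ∈ (0,b]: B·θ_n′(x) + Q(x)·θ_n(x) = ((2n+1)/(2n−3))·[ x²·(B·θ_{n−2}′(x) + Q(x)·θ_{n−2}(x)) − (2n−3)·x·B·θ_{n−2}(x) + (2n−3)·θ_{n−1}(x)·B ]. -/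

import Mathlib

noncomputable section

open MeasureTheory Set Filter Topology Polynomial intervalIntegral

abbrev M2 : Type := Matrix (Fin 2) (Fin 2) ℂ

attribute [local instance] Matrix.normedAddCommGroup Matrix.normedSpace

/-- The matrix `B` of the Dirac system. -/
def Bmat : M2 := !![0, 1; -1, 0]

/-- The Dirac potential built from the scalar functions `p, q`. -/
def diracPot (p q : ℝ → ℂ) : ℝ → M2 := fun x => !![p x, q x; q x, -p x]

/-- Operator norm of a `2 × 2` complex matrix, induced by the Euclidean norm on `ℂ²`. -/
def opNorm (A : M2) : ℝ := ‖Matrix.toEuclideanCLM (𝕜 := ℂ) A‖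

/-- The Legendre polynomial of degree `n` (Rodrigues' formula). -/
def legendreP (n : ℕ) : Polynomial ℝ :=
  ((2 ^ n * n.factorial : ℝ)⁻¹) • (fun r => derivative r)^[n] ((X ^ 2 - 1 : Polynomial ℝ) ^ n)

/-- The domain `Ω⁺ = {(x,t) : 0 ≤ x ≤ b, |t| ≤ x}`. -/
def OmegaPlus (b : ℝ) : Set (ℝ × ℝ) := {z | 0 ≤ z.1 ∧ z.1 ≤ b ∧ |z.2| ≤ z.1}

/-- `K` is a transmutation kernel for the potential `Q` on `Ω⁺`: it satisfies the
hyperbolic PDE `B⬝∂ₓK + ∂ₜK⬝B = -Q⬝K` together with the two Goursat conditions. -/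
def IsTransKernel (b : ℝ) (Q : ℝ → M2) (K : ℝ → ℝ → M2) : Prop :=
  (∀ x t : ℝ, (x, t) ∈ OmegaPlus b →
      Bmat * deriv (fun s => K s t) x + deriv (fun s => K x s) t * Bmat = -(Q x * K x t)) ∧
  (∀ x ∈ Set.Icc (0 : ℝ) b, Bmat * K x x - K x x * Bmat = -Q x) ∧
  (∀ x ∈ Set.Icc (0 : ℝ) b, Bmat * K x (-x) + K x (-x) * Bmat = 0)

/-- The `n`-th Fourier–Legendre coefficient `K_n(x)` of the kernel `K`. -/
def Kcoef (K : ℝ → ℝ → M2) (n : ℕ) (x : ℝ) : M2 :=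
  ((2 * (n : ℝ) + 1) / 2) • ∫ t in (-x)..x, ((legendreP n).eval (t / x)) • K x t

/-- The truncated kernel `K^N(x,t) = Σ_{n=0}^{N} (1/x)·K_n(x)·P_n(t/x)`. -/
def KN (K : ℝ → ℝ → M2) (N : ℕ) (x t : ℝ) : M2 :=
  ∑ n ∈ Finset.range (N + 1), (x⁻¹ * (legendreP n).eval (t / x)) • Kcoef K n x

/-- The free solution `U₀(λ,x)`. -/
def U0 (lam : ℂ) (x : ℝ) : M2 :=
  !![Complex.cos (lam * x), -Complex.sin (lam * x);
     Complex.sin (lam * x), Complex.cos (lam * x)]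

/-- `U(λ,x) = U₀(λ,x) + ∫_{-x}^{x} K(x,t)·U₀(λ,t) dt`. -/
def Umat (K : ℝ → ℝ → M2) (lam : ℂ) (x : ℝ) : M2 :=
  U0 lam x + ∫ t in (-x)..x, K x t * U0 lam t

/-- `U^N(λ,x) = U₀(λ,x) + ∫_{-x}^{x} K^N(x,t)·U₀(λ,t) dt`. -/
def UmatN (K : ℝ → ℝ → M2) (N : ℕ) (lam : ℂ) (x : ℝ) : M2 :=
  U0 lam x + ∫ t in (-x)..x, KN K N x t * U0 lam t

/-- `θ_n(x) = xⁿ·K_n(x)` for `n ≥ 0`, and `θ_{-1}(x) = -K₀(x)/x`. -/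
def theta (K : ℝ → ℝ → M2) (n : ℤ) : ℝ → M2 := fun x =>
  if n = -1 then -(x⁻¹ • Kcoef K 0 x) else (x ^ n.toNat : ℝ) • Kcoef K n.toNat x

/-- The integral operator `S[H](x) = U(x)·∫₀ˣ U(t)⁻¹·Bᵀ·H(t) dt`, where `U = U(0,·)`. -/
def Sop (U : ℝ → M2) (H : ℝ → M2) (x : ℝ) : M2 :=
  U x * ∫ t in (0 : ℝ)..x, (U t)⁻¹ * Bmat.transpose * H t


theorem iter_X_mul (r : ℝ[X]) (k : ℕ) : derivative^[k+1] (X * r) =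
    X * derivative^[k+1] r + ((k:ℝ)+1) • derivative^[k] r := by
  induction k with
  | zero => simp [add_comm]
  | succ k ih =>
    rw [Function.iterate_succ_apply', ih]
    simp only [derivative_add, derivative_mul, derivative_X, derivative_smul,
      ← Function.iterate_succ_apply' (f := derivative), one_mul]
    push_cast
    simp only [smul_eq_C_mul, C_add, C_1]
    ring

theorem leg_def (n : ℕ) : legendreP n =
    ((2 ^ n * n.factorial : ℝ)⁻¹) • derivative^[n] ((X ^ 2 - 1 : ℝ[X]) ^ n) := rfl

theorem leg_der_sq (n : ℕ) : derivative ((X ^ 2 - 1 : ℝ[X]) ^ (n+1))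
    = (2 * ((n:ℝ)+1)) • (X * (X ^ 2 - 1 : ℝ[X]) ^ n) := by
  simp [derivative_pow, smul_eq_C_mul]
  ring

theorem leg_succ (n : ℕ) : legendreP (n+1) =
    ((2 ^ n * n.factorial : ℝ)⁻¹) • derivative^[n] (X * (X ^ 2 - 1 : ℝ[X]) ^ n) := by
  rw [leg_def, Function.iterate_succ_apply, leg_der_sq, iterate_derivative_smul, smul_smul]
  congr 1
  have : (n.factorial : ℝ) ≠ 0 := by positivity
  have : (n + 1 : ℝ) ≠ 0 := by positivity
  rw [Nat.factorial_succ]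
  push_cast
  field_simp
  ring

theorem leg_c (n : ℕ) : derivative (legendreP (n+1)) =
    ((n:ℝ)+1) • legendreP n + X * derivative (legendreP n) := by
  rw [leg_succ, derivative_smul, ← Function.iterate_succ_apply' (f := derivative), iter_X_mul, leg_def,
    derivative_smul, Function.iterate_succ_apply' (f := derivative)]
  simp only [smul_eq_C_mul]
  ring

theorem leg_a (n : ℕ) : derivative (legendreP (n+2)) =
    (2*(n:ℝ)+3) • legendreP (n+1) + derivative (legendreP n) := by
  have key : derivative (X * (X ^ 2 - 1 : ℝ[X]) ^ (n+1)) =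
      (2*(n:ℝ)+3) • (X ^ 2 - 1 : ℝ[X]) ^ (n+1) + (2*((n:ℝ)+1)) • (X ^ 2 - 1 : ℝ[X]) ^ n := by
    rw [derivative_mul, leg_der_sq]
    simp [smul_eq_C_mul]
    have h2 : (C 2 : ℝ[X]) = 2 := rfl
    have h3 : (C 3 : ℝ[X]) = 3 := rfl
    rw [h2, h3]
    ring
  rw [leg_succ, derivative_smul, ← Function.iterate_succ_apply' (f := derivative),
    Function.iterate_succ_apply, key, iterate_map_add, iterate_derivative_smul,
    iterate_derivative_smul, leg_def (n+1), leg_def n, smul_add, derivative_smul,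
    ← Function.iterate_succ_apply' (f := derivative) , smul_comm, smul_smul _ (2*((n:ℝ)+1))]
  congr 2
  have : (n.factorial : ℝ) ≠ 0 := by positivity
  have : (n + 1 : ℝ) ≠ 0 := by positivity
  rw [Nat.factorial_succ]
  push_cast
  field_simp
  ring

theorem leg_zero : legendreP 0 = 1 := by simp [leg_def]
theorem leg_one : legendreP 1 = X := by simp [leg_succ]

theorem leg_eval_one (n : ℕ) : (legendreP n).eval 1 = 1 := by
  induction n with
  | zero => simp [leg_zero]
  | succ n ih =>
    cases n with
    | zero => simp [leg_one]
    | succ m =>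
      rw [leg_succ, iter_X_mul, smul_add, ← mul_smul_comm, ← leg_def]
      simp only [eval_add, eval_mul, eval_X, ih, eval_smul]
      have h := pow_sub_dvd_iterate_derivative_pow (X ^ 2 - 1 : ℝ[X]) (m+1) m
      obtain ⟨c, hc⟩ := h
      rw [hc]
      simp

/-- Combination used for the coefficient of `B` on the left. -/
theorem leg_b (n : ℕ) : ((n:ℝ)+2) • legendreP (n+2) - X * derivative (legendreP (n+2)) =
    (n:ℝ) • legendreP n - X * derivative (legendreP n) - (2*(n:ℝ)+1) • legendreP n := by
  have h1 := leg_c n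
  have h2 := leg_c (n+1)
  have h3 := leg_a n
  push_cast at h2
  have e1 : X * derivative (legendreP (n+2)) = ((n:ℝ)+2) • legendreP (n+2) + derivative (legendreP (n+1)) := by
    have h4 := leg_c (n+2)
    have h5 := leg_a (n+1)
    push_cast at h4 h5
    have : X * derivative (legendreP (n+2)) = derivative (legendreP (n+3)) - ((n:ℝ)+2+1) • legendreP (n+2) := by
      rw [h4]; ring
    rw [this, h5]
    simp only [smul_eq_C_mul, C_add, C_mul, C_1]
    have h2 : (C 2 : ℝ[X]) = 2 := rfl
    have h3 : (C 3 : ℝ[X]) = 3 := rfl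
    rw [h2, h3]
    ring
  rw [e1, h1]
  simp only [smul_eq_C_mul, C_add, C_mul, C_1]
  have : (C 2 : ℝ[X]) = 2 := rfl
  rw [this]
  ring

section generic
variable {E : Type*} [NormedAddCommGroup E] [NormedSpace ℝ E] [CompleteSpace E]

theorem hasDerivWithin_param {b : ℝ} (hb : 0 < b) (κ : ℝ → ℝ → E) (H : ℝ × ℝ → E) (f : ℝ → ℝ)
    (hf : Continuous f)
    (hH : ContinuousOn H (Icc 0 b ×ˢ Icc (-1) 1))
    (hκ0 : ContinuousOn (κ 0) (Icc (-1) 1))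
    (hκ : ∀ s ∈ Icc (-1:ℝ) 1, ∀ x ∈ Icc 0 b,
      HasDerivWithinAt (fun y => κ y s) (H (x, s)) (Icc 0 b) x)
    (x : ℝ) (hx : x ∈ Icc 0 b) :
    HasDerivWithinAt (fun y => ∫ s in (-1:ℝ)..1, f s • κ y s)
      (∫ s in (-1:ℝ)..1, f s • H (x, s)) (Icc 0 b) x := by
  have h11 : (-1:ℝ) ≤ 1 := by norm_num
  set H' : ℝ → ℝ → E := fun y s => f s • H (projIcc 0 b hb.le y, projIcc (-1) 1 h11 s) with hH'
  have hc : Continuous (Function.uncurry H') := by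
    have h1 : Continuous (fun z : ℝ × ℝ => H (projIcc 0 b hb.le z.1, projIcc (-1) 1 h11 z.2)) :=
      hH.comp_continuous (by fun_prop) (fun z => ⟨(projIcc 0 b hb.le z.1).2, (projIcc (-1) 1 h11 z.2).2⟩)
    exact (hf.comp continuous_snd).smul h1
  have hc2 : Continuous (fun y => ∫ s in (-1:ℝ)..1, H' y s) :=
    intervalIntegral.continuous_parametric_intervalIntegral_of_continuous' hc _ _
  have hder := (hc2.integral_hasStrictDerivAt 0 x).hasDerivAt.hasDerivWithinAt (s := Icc 0 b)
  have hder2 := hder.const_add (∫ s in (-1:ℝ)..1, f s • κ 0 s)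
  have hval : (∫ s in (-1:ℝ)..1, H' x s) = ∫ s in (-1:ℝ)..1, f s • H (x, s) := by
    apply intervalIntegral.integral_congr
    intro s hs
    rw [uIcc_of_le h11] at hs
    simp only [hH', projIcc_of_mem hb.le hx, projIcc_of_mem h11 hs]
  rw [hval] at hder2
  refine hder2.congr_of_mem ?_ hx
  intro y hy
  have hsw : (∫ u in (0:ℝ)..y, ∫ s in (-1:ℝ)..1, H' u s) = ∫ s in (-1:ℝ)..1, ∫ u in (0:ℝ)..y, H' u s := by
    rw [intervalIntegral.integral_of_le h11]
    simp_rw [intervalIntegral.integral_of_le h11]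
    rw [intervalIntegral_integral_swap]
    have := (hc.continuousOn (s := Icc (min 0 y) (max 0 y) ×ˢ Icc (-1) 1)).integrableOn_compact
      (μ := volume) (isCompact_Icc.prod isCompact_Icc)
    rw [IntegrableOn, Measure.volume_eq_prod, ← Measure.prod_restrict] at this
    refine this.mono_measure ?_
    apply Measure.prod_mono
    · exact Measure.restrict_mono Ioc_subset_Icc_self le_rfl
    · exact Measure.restrict_mono Ioc_subset_Icc_self le_rfl
  rw [hsw, ← intervalIntegral.integral_add]
  · apply intervalIntegral.integral_congr
    intro s hs
    rw [uIcc_of_le h11] at hs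
    have : ∫ u in (0:ℝ)..y, H' u s = f s • κ y s - f s • κ 0 s := by
      apply intervalIntegral.integral_eq_sub_of_hasDerivAt_of_le (f := fun u => f s • κ u s) hy.1
      · intro u hu
        have hu' : u ∈ Icc 0 b := ⟨hu.1, hu.2.trans hy.2⟩
        exact ((hκ s hs u hu').continuousWithinAt.mono (Icc_subset_Icc_right hy.2)).const_smul (f s)
      · intro u hu
        have hu' : u ∈ Icc 0 b := ⟨hu.1.le, hu.2.le.trans hy.2⟩
        have := ((hκ s hs u hu').hasDerivAt (Icc_mem_nhds hu.1 (hu.2.trans_le hy.2))).const_smul (f s)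
        simp only [hH', projIcc_of_mem hb.le hu', projIcc_of_mem h11 hs]
        exact this
      · exact (hc.comp (by fun_prop : Continuous (fun u : ℝ => (u, s)))).intervalIntegrable _ _
    simp only [this]
    abel
  · apply ContinuousOn.intervalIntegrable
    rw [uIcc_of_le h11]
    exact hf.continuousOn.smul hκ0
  · apply Continuous.intervalIntegrable
    exact intervalIntegral.continuous_parametric_intervalIntegral_of_continuous'
      (f := fun s u => H' u s) (hc.comp continuous_swap) _ _

theorem ii_poly (g : ℝ[X]) {h : ℝ → E} (hh : ContinuousOn h (Icc (-1) 1)) :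
    IntervalIntegrable (fun s => g.eval s • h s) volume (-1) 1 := by
  apply ContinuousOn.intervalIntegrable
  rw [uIcc_of_le (by norm_num : (-1:ℝ) ≤ 1)]
  exact g.continuous.continuousOn.smul hh

theorem by_parts (f : ℝ[X]) (κ κ' : ℝ → E) (hκ : ContinuousOn κ (Icc (-1) 1))
    (hκ' : ContinuousOn κ' (Icc (-1) 1))
    (hd : ∀ s ∈ Ioo (-1:ℝ) 1, HasDerivAt κ (κ' s) s) :
    ∫ s in (-1:ℝ)..1, f.eval s • κ' s = f.eval 1 • κ 1 - f.eval (-1) • κ (-1) -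
      ∫ s in (-1:ℝ)..1, (derivative f).eval s • κ s := by
  have h11 : (-1:ℝ) ≤ 1 := by norm_num
  have i1 : IntervalIntegrable (fun s => f.eval s • κ' s) volume (-1) 1 := by
    apply ContinuousOn.intervalIntegrable
    rw [uIcc_of_le h11]
    exact f.continuous.continuousOn.smul hκ'
  have i2 : IntervalIntegrable (fun s => (derivative f).eval s • κ s) volume (-1) 1 := by
    apply ContinuousOn.intervalIntegrable
    rw [uIcc_of_le h11]
    exact (derivative f).continuous.continuousOn.smul hκ
  rw [eq_sub_iff_add_eq, ← intervalIntegral.integral_add i1 i2]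
  apply intervalIntegral.integral_eq_sub_of_hasDerivAt_of_le (f := fun u => f.eval u • κ u) h11
  · exact f.continuous.continuousOn.smul hκ
  · intro s hs
    exact (f.hasDerivAt s).smul (hd s hs)
  · exact i1.add i2

theorem clm_comb (L R N : E →L[ℝ] E) (f : ℝ[X]) (x : ℝ) (c u a k : ℝ → E)
    (hc : ContinuousOn c (Icc (-1) 1)) (ha : ContinuousOn a (Icc (-1) 1))
    (hk : ContinuousOn k (Icc (-1) 1))
    (hcu : ∀ s ∈ Icc (-1:ℝ) 1, c s = u s + s • a s)
    (hrel : ∀ s ∈ Icc (-1:ℝ) 1, L (u s) + R (a s) = -N (k s)) :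
    x • (L (∫ s in (-1:ℝ)..1, f.eval s • c s) + N (∫ s in (-1:ℝ)..1, f.eval s • k s)) =
      L (∫ s in (-1:ℝ)..1, (X * f).eval s • (x • a s)) -
        R (∫ s in (-1:ℝ)..1, f.eval s • (x • a s)) := by
  have h11 : (-1:ℝ) ≤ 1 := by norm_num
  have i1 := ii_poly f hc
  have i2 := ii_poly f hk
  have i3 : IntervalIntegrable (fun s => (X * f).eval s • (x • a s)) volume (-1) 1 :=
    ii_poly (X * f) (ha.const_smul x)
  have i4 : IntervalIntegrable (fun s => f.eval s • (x • a s)) volume (-1) 1 :=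
    ii_poly f (ha.const_smul x)
  have cl : ∀ (T : E →L[ℝ] E) (h : ℝ → E), IntervalIntegrable h volume (-1) 1 →
      IntervalIntegrable (fun s => T (h s)) volume (-1) 1 := fun T h hh =>
    ⟨T.integrable_comp hh.1, T.integrable_comp hh.2⟩
  rw [← L.intervalIntegral_comp_comm i1, ← N.intervalIntegral_comp_comm i2,
    ← L.intervalIntegral_comp_comm i3, ← R.intervalIntegral_comp_comm i4,
    ← intervalIntegral.integral_add (cl L _ i1) (cl N _ i2),
    ← intervalIntegral.integral_sub (cl L _ i3) (cl R _ i4), ← intervalIntegral.integral_smul]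
  apply intervalIntegral.integral_congr
  intro s hs
  rw [uIcc_of_le h11] at hs
  have hp2 : N (k s) = -L (u s) - R (a s) := by
    rw [← neg_eq_iff_eq_neg.2 (hrel s hs)]; abel
  simp only [map_smul, hcu s hs, map_add, hp2, eval_mul, eval_X]
  module

end generic
/-- Left multiplication as a continuous linear map. -/
def mulLc (M : M2) : M2 →L[ℝ] M2 := LinearMap.toContinuousLinearMap (LinearMap.mulLeft ℝ M)
/-- Right multiplication as a continuous linear map. -/
def mulRc (M : M2) : M2 →L[ℝ] M2 := LinearMap.toContinuousLinearMap (LinearMap.mulRight ℝ M)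

theorem mulLc_apply (M A : M2) : mulLc M A = M * A := rfl
theorem mulRc_apply (M A : M2) : mulRc M A = A * M := rfl

theorem omega_convex (b : ℝ) : Convex ℝ (OmegaPlus b) := by
  rintro ⟨x, t⟩ ⟨h1, h2, h3⟩ ⟨y, u⟩ ⟨k1, k2, k3⟩ α β hα hβ hαβ
  simp only at h1 h2 h3 k1 k2 k3
  rw [abs_le] at h3 k3
  refine ⟨?_, ?_, ?_⟩
  · simp; positivity
  · simp
    calc α * x + β * y ≤ α * b + β * b := by gcongr
      _ = b := by rw [← add_mul, hαβ, one_mul]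
  · simp
    rw [abs_le]
    constructor
    · nlinarith [mul_le_mul_of_nonneg_left h3.1 hα, mul_le_mul_of_nonneg_left k3.1 hβ]
    · nlinarith [mul_le_mul_of_nonneg_left h3.2 hα, mul_le_mul_of_nonneg_left k3.2 hβ]

theorem omega_nhds {b x t : ℝ} (h1 : x < b) (h2 : |t| < x) : OmegaPlus b ∈ 𝓝 (x, t) := by
  have ho : IsOpen {z : ℝ × ℝ | z.1 < b ∧ |z.2| < z.1} := by
    apply IsOpen.and
    · exact isOpen_lt (by fun_prop) (by fun_prop)
    · exact isOpen_lt (by fun_prop) (by fun_prop)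
  refine mem_of_superset (ho.mem_nhds ⟨h1, h2⟩) ?_
  rintro ⟨y, u⟩ ⟨k1, k2⟩
  exact ⟨(abs_nonneg u).trans k2.le, k1.le, k2.le⟩

theorem omega_int_nonempty {b : ℝ} (hb : 0 < b) : (interior (OmegaPlus b)).Nonempty :=
  ⟨(b/2, 0), mem_interior_iff_mem_nhds.2 (omega_nhds (by linarith) (by simp; linarith))⟩

theorem omega_mem {b x s : ℝ} (hx : x ∈ Icc 0 b) (hs : s ∈ Icc (-1:ℝ) 1) :
    (x, x * s) ∈ OmegaPlus b := by
  refine ⟨hx.1, hx.2, ?_⟩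
  simp only [abs_mul, abs_of_nonneg hx.1]
  have : |s| ≤ 1 := abs_le.2 hs
  nlinarith [hx.1]

/-- The PDE, for the one-sided derivatives, everywhere on `Ω⁺`. -/
theorem pde_within {b : ℝ} (hb : 0 < b) (Q : ℝ → M2) (hQ : ContinuousOn Q (Icc 0 b))
    (K : ℝ → ℝ → M2)
    (hK : ContDiffOn ℝ 1 (fun z : ℝ × ℝ => K z.1 z.2) (OmegaPlus b))
    (hker : IsTransKernel b Q K) (z : ℝ × ℝ) (hz : z ∈ OmegaPlus b) :
    Bmat * (fderivWithin ℝ (fun z : ℝ × ℝ => K z.1 z.2) (OmegaPlus b) z (1, 0)) +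
      (fderivWithin ℝ (fun z : ℝ × ℝ => K z.1 z.2) (OmegaPlus b) z (0, 1)) * Bmat =
      -(Q z.1 * K z.1 z.2) := by
  have hu : UniqueDiffOn ℝ (OmegaPlus b) := uniqueDiffOn_convex (omega_convex b) (omega_int_nonempty hb)
  have hA := hK.continuousOn_fderivWithin hu le_rfl
  have hcl : OmegaPlus b ⊆ closure (interior (OmegaPlus b)) := by
    rw [(omega_convex b).closure_interior_eq_closure_of_nonempty_interior (omega_int_nonempty hb)]
    exact subset_closure
  refine Set.EqOn.of_subset_closure (f := fun z => Bmat * (fderivWithin ℝ (fun z : ℝ × ℝ => K z.1 z.2) (OmegaPlus b) z (1, 0)) +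
      (fderivWithin ℝ (fun z : ℝ × ℝ => K z.1 z.2) (OmegaPlus b) z (0, 1)) * Bmat)
      (g := fun z => -(Q z.1 * K z.1 z.2)) ?_ ?_ ?_ interior_subset hcl hz
  · rintro ⟨x, t⟩ hxt
    have hmem := mem_interior_iff_mem_nhds.1 hxt
    have hd : HasFDerivAt (fun z : ℝ × ℝ => K z.1 z.2)
        (fderivWithin ℝ (fun z : ℝ × ℝ => K z.1 z.2) (OmegaPlus b) (x, t)) (x, t) :=
      ((hK.differentiableOn one_ne_zero (x, t) (interior_subset hxt)).hasFDerivWithinAt).hasFDerivAt hmem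
    have d1 : HasDerivAt (fun s => K s t)
        (fderivWithin ℝ (fun z : ℝ × ℝ => K z.1 z.2) (OmegaPlus b) (x, t) (1, 0)) x :=
      HasFDerivAt.comp_hasDerivAt (f := fun s : ℝ => (s, t)) x hd
        ((hasDerivAt_id x).prodMk (hasDerivAt_const x t))
    have d2 : HasDerivAt (fun s => K x s)
        (fderivWithin ℝ (fun z : ℝ × ℝ => K z.1 z.2) (OmegaPlus b) (x, t) (0, 1)) t :=
      HasFDerivAt.comp_hasDerivAt (f := fun s : ℝ => (x, s)) t hd
        ((hasDerivAt_const t x).prodMk (hasDerivAt_id t))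
    have := hker.1 x t (interior_subset hxt)
    have e1 : deriv (fun s => K s t) x =
      fderivWithin ℝ (fun z : ℝ × ℝ => K z.1 z.2) (OmegaPlus b) (x, t) (1, 0) := d1.deriv
    have e2 : deriv (fun s => K x s) t =
      fderivWithin ℝ (fun z : ℝ × ℝ => K z.1 z.2) (OmegaPlus b) (x, t) (0, 1) := d2.deriv
    rw [e1, e2] at this
    exact this
  · have c1 : ContinuousOn (fun z => fderivWithin ℝ (fun z : ℝ × ℝ => K z.1 z.2) (OmegaPlus b) z (1, 0)) (OmegaPlus b) :=
      hA.clm_apply continuousOn_const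
    have c2 : ContinuousOn (fun z => fderivWithin ℝ (fun z : ℝ × ℝ => K z.1 z.2) (OmegaPlus b) z (0, 1)) (OmegaPlus b) :=
      hA.clm_apply continuousOn_const
    exact ((mulLc Bmat).continuous.comp_continuousOn c1).add ((mulRc Bmat).continuous.comp_continuousOn c2)
  · have c1 : ContinuousOn (fun z : ℝ × ℝ => Q z.1) (OmegaPlus b) :=
      hQ.comp continuousOn_fst (fun z hz => ⟨hz.1, hz.2.1⟩)
    exact (c1.mul hK.continuousOn).neg

/-- The integral `∫_{-1}^1 f(s) K(x, x s) ds`. -/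
def Jint (K : ℝ → ℝ → M2) (f : ℝ[X]) (x : ℝ) : M2 :=
  ∫ s in (-1:ℝ)..1, f.eval s • K x (x * s)

theorem core {b : ℝ} (hb : 0 < b) (Q : ℝ → M2) (hQ : ContinuousOn Q (Icc 0 b))
    (K : ℝ → ℝ → M2)
    (hK : ContDiffOn ℝ 1 (fun z : ℝ × ℝ => K z.1 z.2) (OmegaPlus b))
    (hker : IsTransKernel b Q K) (f : ℝ[X]) (hf1 : f.eval 1 = 1) (x : ℝ) (hx : x ∈ Ioc 0 b) :
    ∃ G' : M2, HasDerivWithinAt (Jint K f) G' (Icc 0 b) x ∧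
      x • (Bmat * G' + Q x * Jint K f x) = -Q x - Bmat * Jint K (derivative (X * f)) x
        + Jint K (derivative f) x * Bmat := by
  have hx' : x ∈ Icc 0 b := ⟨hx.1.le, hx.2⟩
  have h11 : (-1:ℝ) ≤ 1 := by norm_num
  have hu : UniqueDiffOn ℝ (OmegaPlus b) := uniqueDiffOn_convex (omega_convex b) (omega_int_nonempty hb)
  have hpde := pde_within hb Q hQ K hK hker
  have hA := hK.continuousOn_fderivWithin hu le_rfl
  have hdiff : ∀ z ∈ OmegaPlus b, HasFDerivWithinAt (fun z : ℝ × ℝ => K z.1 z.2)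
      (fderivWithin ℝ (fun z : ℝ × ℝ => K z.1 z.2) (OmegaPlus b) z) (OmegaPlus b) z :=
    fun z hz => (hK.differentiableOn one_ne_zero z hz).hasFDerivWithinAt
  have hKc := hK.continuousOn
  set A := fderivWithin ℝ (fun z : ℝ × ℝ => K z.1 z.2) (OmegaPlus b) with hAdef
  have hAsplit : ∀ z (s : ℝ), A z (1, s) = A z (1, 0) + s • A z (0, 1) := by
    intro z s
    rw [← map_smul, ← map_add]
    simp
  have hmaps : MapsTo (fun s => (x, x * s)) (Icc (-1:ℝ) 1) (OmegaPlus b) :=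
    fun s hs => omega_mem hx' hs
  have hAx : ContinuousOn (fun s => A (x, x * s)) (Icc (-1) 1) :=
    hA.comp (f := fun s : ℝ => (x, x * s)) (by fun_prop) hmaps
  have ct : ContinuousOn (fun s => A (x, x * s) (0, 1)) (Icc (-1) 1) :=
    hAx.clm_apply continuousOn_const
  have cx : ContinuousOn (fun s => A (x, x * s) (1, s)) (Icc (-1) 1) :=
    hAx.clm_apply (by fun_prop)
  have ck : ContinuousOn (fun s => K x (x * s)) (Icc (-1) 1) :=
    hKc.comp (f := fun s : ℝ => (x, x * s)) (by fun_prop) hmaps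
  refine ⟨∫ s in (-1:ℝ)..1, f.eval s • A (x, x * s) (1, s), ?_, ?_⟩
  · refine hasDerivWithin_param hb (fun y s => K y (y * s)) (fun z => A (z.1, z.1 * z.2) (1, z.2))
      (fun s => f.eval s) f.continuous ?_ ?_ ?_ x hx'
    · have : ContinuousOn (fun z : ℝ × ℝ => A (z.1, z.1 * z.2)) (Icc 0 b ×ˢ Icc (-1) 1) :=
        hA.comp (f := fun z : ℝ × ℝ => (z.1, z.1 * z.2)) (by fun_prop)
          (fun z hz => omega_mem hz.1 hz.2)
      exact this.clm_apply (by fun_prop)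
    · simp only [zero_mul]
      exact continuousOn_const
    · intro s hs y hy
      have := HasFDerivWithinAt.comp_hasDerivWithinAt (f := fun y : ℝ => (y, y * s)) (s := Icc 0 b) y
        (hdiff _ (omega_mem hy hs))
        (((hasDerivAt_id y).prodMk ((hasDerivAt_id y).mul_const s)).hasDerivWithinAt)
        (fun u hu => omega_mem hu hs)
      simp only [one_mul] at this
      exact this
  · have bp := fun g : ℝ[X] => by_parts g (fun s => K x (x * s)) (fun s => x • A (x, x * s) (0, 1))
      ck (ct.const_smul x) (by
        intro s hs
        have h0 := HasFDerivWithinAt.comp_hasDerivWithinAt (f := fun s : ℝ => (x, x * s))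
          (s := Icc (-1) 1) s (hdiff _ (omega_mem hx' ⟨hs.1.le, hs.2.le⟩))
          (((hasDerivAt_const s x).prodMk ((hasDerivAt_id s).const_mul x)).hasDerivWithinAt) hmaps
        have h1 := h0.hasDerivAt (Icc_mem_nhds hs.1 hs.2)
        have h2 : A (x, x * s) (0, x * 1) = x • A (x, x * s) (0, 1) := by
          rw [← map_smul]; simp
        rw [← h2]
        exact h1)
    have e3 : x • (Bmat * (∫ s in (-1:ℝ)..1, f.eval s • A (x, x * s) (1, s)) + Q x * Jint K f x)
        = Bmat * (∫ s in (-1:ℝ)..1, (X * f).eval s • (x • A (x, x * s) (0, 1))) -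
          (∫ s in (-1:ℝ)..1, f.eval s • (x • A (x, x * s) (0, 1))) * Bmat := by
      exact clm_comb (mulLc Bmat) (mulRc Bmat) (mulLc (Q x)) f x
        (fun s => A (x, x * s) (1, s)) (fun s => A (x, x * s) (1, 0)) (fun s => A (x, x * s) (0, 1))
        (fun s => K x (x * s)) cx ct ck (fun s _ => hAsplit _ s)
        (fun s hs => hpde (x, x * s) (omega_mem hx' hs))
    rw [e3, bp, bp]
    have hJ : ∀ g : ℝ[X], ∫ s in (-1:ℝ)..1, g.eval s • K x (x * s) = Jint K g x := fun g => rfl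
    have g1 := hker.2.1 x hx'
    have g2 := hker.2.2 x hx'
    simp only [eval_mul, eval_X, hf1, mul_one, mul_neg, one_smul, hJ, one_mul, neg_mul, neg_smul]
    have g2' : K x (-x) * Bmat = - (Bmat * K x (-x)) := by rw [eq_neg_iff_add_eq_zero, add_comm, g2]
    rw [← g1]
    simp only [mul_sub, sub_mul, mul_neg, neg_mul, mul_smul_comm, smul_mul_assoc, g2']
    module

theorem Kcoef_eq (K : ℝ → ℝ → M2) (n : ℕ) (y : ℝ) :
    Kcoef K n y = ((2 * (n:ℝ) + 1) / 2 * y) • Jint K (legendreP n) y := by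
  rw [Kcoef, Jint, mul_smul]
  congr 1
  have := intervalIntegral.smul_integral_comp_mul_left (a := -1) (b := 1)
    (fun t => ((legendreP n).eval (t / y)) • K y t) y
  simp only [mul_neg, mul_one] at this
  rw [← this]
  rcases eq_or_ne y 0 with rfl | hy
  · simp
  · congr 1
    apply intervalIntegral.integral_congr
    intro s _
    simp only
    rw [mul_div_cancel_left₀ _ hy]

theorem theta_nat (K : ℝ → ℝ → M2) (n : ℕ) (y : ℝ) :
    theta K (n:ℤ) y = ((2 * (n:ℝ) + 1) / 2 * y ^ (n+1)) • Jint K (legendreP n) y := by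
  have : (n:ℤ) ≠ -1 := by omega
  simp only [theta, this, if_false, Int.toNat_natCast, Kcoef_eq, smul_smul]
  congr 1
  ring

theorem Jint_lin {b : ℝ} (K : ℝ → ℝ → M2)
    (hK : ContDiffOn ℝ 1 (fun z : ℝ × ℝ => K z.1 z.2) (OmegaPlus b)) (x : ℝ) (hx : x ∈ Icc 0 b) :
    (∀ f g, Jint K (f + g) x = Jint K f x + Jint K g x) ∧
    (∀ (c : ℝ) f, Jint K (c • f) x = c • Jint K f x) := by
  have h11 : (-1:ℝ) ≤ 1 := by norm_num
  have ck : ContinuousOn (fun s => K x (x * s)) (Icc (-1) 1) :=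
    hK.continuousOn.comp (f := fun s : ℝ => (x, x * s)) (by fun_prop) (fun s hs => omega_mem hx hs)
  constructor
  · intro f g
    simp only [Jint, eval_add, add_smul]
    exact intervalIntegral.integral_add (ii_poly f ck) (ii_poly g ck)
  · intro c f
    simp only [Jint, eval_smul, smul_assoc]
    exact intervalIntegral.integral_smul c _

/-- The Dirac operator applied to theta, in closed form. -/
theorem theta_D {b : ℝ} (hb : 0 < b) (Q : ℝ → M2) (hQ : ContinuousOn Q (Icc 0 b))
    (K : ℝ → ℝ → M2)
    (hK : ContDiffOn ℝ 1 (fun z : ℝ × ℝ => K z.1 z.2) (OmegaPlus b))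
    (hker : IsTransKernel b Q K) (n : ℕ) (x : ℝ) (hx : x ∈ Ioc 0 b) :
    Bmat * derivWithin (theta K (n : ℤ)) (Set.Icc 0 b) x + Q x * theta K (n : ℤ) x =
      ((2 * (n:ℝ) + 1) / 2 * x ^ n) • (-Q x
        + Bmat * Jint K ((n:ℝ) • legendreP n - X * derivative (legendreP n)) x
        + Jint K (derivative (legendreP n)) x * Bmat) := by
  have hx' : x ∈ Icc 0 b := ⟨hx.1.le, hx.2⟩
  obtain ⟨G', hG, hG2⟩ := core hb Q hQ K hK hker (legendreP n) (leg_eval_one n) x hx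
  obtain ⟨ladd, lsmul⟩ := Jint_lin K hK x hx'
  have hfun : theta K (n:ℤ) = fun y => ((2 * (n:ℝ) + 1) / 2 * y ^ (n+1)) • Jint K (legendreP n) y :=
    funext (theta_nat K n)
  have hd := (((hasDerivAt_pow (n+1) x).const_mul ((2 * (n:ℝ) + 1) / 2)).hasDerivWithinAt
    (s := Icc 0 b)).smul hG
  have hud := uniqueDiffOn_Icc hb x hx'
  have hdw : derivWithin (theta K (n:ℤ)) (Icc 0 b) x =
      ((2 * (n:ℝ) + 1) / 2 * x ^ (n + 1)) • G' +
        ((2 * (n:ℝ) + 1) / 2 * (((n + 1 : ℕ) : ℝ) * x ^ (n + 1 - 1))) • Jint K (legendreP n) x := by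
    rw [hfun]; exact hd.derivWithin hud
  rw [hdw, theta_nat]
  have hp : derivative (X * legendreP n) =
      ((n:ℝ) + 1) • legendreP n + (-1:ℝ) • ((n:ℝ) • legendreP n - X * derivative (legendreP n)) := by
    simp only [derivative_mul, derivative_X, smul_eq_C_mul, C_add, C_1, C_neg]
    ring
  rw [hp, ladd, lsmul, lsmul] at hG2
  have hG3 : Bmat * Jint K ((n:ℝ) • legendreP n - X * derivative (legendreP n)) x
        + Jint K (derivative (legendreP n)) x * Bmat - Q x =
        x • (Bmat * G' + Q x * Jint K (legendreP n) x) + ((n:ℝ)+1) • (Bmat * Jint K (legendreP n) x) := by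
    rw [hG2]
    simp only [mul_add, mul_smul_comm]
    module
  rw [show ∀ a c d : M2, -a + c + d = c + d - a from fun a c d => by abel, hG3]
  simp only [mul_add, mul_smul_comm]
  push_cast
  module

theorem theta_neg_D {b : ℝ} (hb : 0 < b) (Q : ℝ → M2) (hQ : ContinuousOn Q (Icc 0 b))
    (K : ℝ → ℝ → M2)
    (hK : ContDiffOn ℝ 1 (fun z : ℝ × ℝ => K z.1 z.2) (OmegaPlus b))
    (hker : IsTransKernel b Q K) (x : ℝ) (hx : x ∈ Ioc 0 b) :
    x • (Bmat * derivWithin (theta K (-1)) (Set.Icc 0 b) x + Q x * theta K (-1) x) =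
      (1 / 2 : ℝ) • (Q x + Bmat * Jint K 1 x) ∧ theta K (-1) x = (-(1/2) : ℝ) • Jint K 1 x := by
  have hx' : x ∈ Icc 0 b := ⟨hx.1.le, hx.2⟩
  obtain ⟨G', hG, hG2⟩ := core hb Q hQ K hK hker 1 (by simp) x hx
  have hth : ∀ y ≠ 0, theta K (-1) y = (-(1/2) : ℝ) • Jint K 1 y := by
    intro y hy
    simp only [theta, if_true, Kcoef_eq, leg_zero, smul_smul, ← neg_smul]
    congr 1
    push_cast
    field_simp
    ring
  have hev : theta K (-1) =ᶠ[𝓝[Icc 0 b] x] fun y => (-(1/2) : ℝ) • Jint K 1 y := by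
    filter_upwards [mem_nhdsWithin_of_mem_nhds (Ioi_mem_nhds hx.1)] with y hy
    exact hth y (ne_of_gt hy)
  have hd := (hG.const_smul (-(1/2) : ℝ)).congr_of_eventuallyEq hev (hth x hx.1.ne')
  have hx0 := hth x hx.1.ne'
  refine ⟨?_, hx0⟩
  have hdw : derivWithin (theta K (-1)) (Icc 0 b) x = (-(1/2) : ℝ) • G' :=
    hd.derivWithin (uniqueDiffOn_Icc hb x hx')
  rw [hdw, hx0]
  have j0 : Jint K (derivative (1:ℝ[X])) x = 0 := by simp [Jint]
  rw [j0] at hG2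
  simp only [mul_one, derivative_X, zero_mul, add_zero] at hG2
  have : Bmat * (-(1/2) : ℝ) • G' + Q x * (-(1/2) : ℝ) • Jint K 1 x =
      (-(1/2) : ℝ) • (Bmat * G' + Q x * Jint K 1 x) := by
    simp only [mul_smul_comm]; module
  rw [this, smul_comm, hG2]
  module

/-- the coupled recursive system of differential equations for `θ_n = xⁿKₙ`. -/
theorem statement7 (b : ℝ) (hb : 0 < b) (p q : ℝ → ℂ)
    (hQ : ContDiffOn ℝ 1 (diracPot p q) (Set.Icc 0 b))
    (K : ℝ → ℝ → M2)
    (hK : ContDiffOn ℝ 1 (fun z : ℝ × ℝ => K z.1 z.2) (OmegaPlus b))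
    (hker : IsTransKernel b (diracPot p q) K) :
    (∀ n : ℕ, 1 ≤ n → theta K (n : ℤ) 0 = 0) ∧
    (∀ n : ℕ, 1 ≤ n → ∀ x ∈ Set.Ioc 0 b,
      Bmat * derivWithin (theta K (n : ℤ)) (Set.Icc 0 b) x
          + diracPot p q x * theta K (n : ℤ) x
        = ((2 * (n : ℝ) + 1) / (2 * (n : ℝ) - 3)) •
          (x ^ 2 • (Bmat * derivWithin (theta K ((n : ℤ) - 2)) (Set.Icc 0 b) x
              + diracPot p q x * theta K ((n : ℤ) - 2) x)
            - ((2 * (n : ℝ) - 3) * x) • (Bmat * theta K ((n : ℤ) - 2) x)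
            + (2 * (n : ℝ) - 3) • (theta K ((n : ℤ) - 1) x * Bmat))) := by


  have hQc := hQ.continuousOn
  refine ⟨?_, ?_⟩
  · intro n hn
    rw [theta_nat]
    simp
  · intro n hn x hx
    have hx' : x ∈ Icc 0 b := ⟨hx.1.le, hx.2⟩
    obtain ⟨ladd, lsmul⟩ := Jint_lin K hK x hx'
    rw [theta_D hb _ hQc K hK hker n x hx]
    obtain rfl | ⟨m, rfl⟩ : n = 1 ∨ ∃ m, n = m + 2 := by
      rcases n with _ | _ | m
      · omega
      · exact Or.inl rfl
      · exact Or.inr ⟨m, rfl⟩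
    · obtain ⟨h1, h2⟩ := theta_neg_D hb _ hQc K hK hker x hx
      have t0 := theta_nat K 0 x
      have j0 : Jint K ((1:ℝ) • legendreP 1 - X * derivative (legendreP 1)) x = 0 := by
        simp [leg_one, Jint]
      have j1 : Jint K (derivative (legendreP 1)) x = Jint K 1 x := by simp [leg_one]
      rw [leg_zero] at t0
      have k1 : (((1:ℕ):ℤ) - 2) = -1 := by norm_num
      have k2 : (((1:ℕ):ℤ) - 1) = ((0:ℕ):ℤ) := by norm_num
      rw [k1, k2, Nat.cast_one, j0, j1, pow_two, mul_smul x x, h1, h2, t0]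
      simp only [mul_smul_comm, smul_mul_assoc, mul_zero]
      push_cast
      match_scalars <;> ring
    · have t1 := theta_nat K (m+1) x
      have t2 := theta_nat K m x
      have i1 : ((m+2 : ℕ) : ℤ) - 2 = (m:ℤ) := by push_cast; ring
      have i2 : ((m+2 : ℕ) : ℤ) - 1 = ((m+1 : ℕ):ℤ) := by push_cast; ring
      rw [i1, i2, theta_D hb _ hQc K hK hker m x hx, t1, t2, leg_a]
      have hbb : (((m+2:ℕ):ℝ)) • legendreP (m+2) - X * derivative (legendreP (m+2)) =
          ((m:ℝ) • legendreP m - X * derivative (legendreP m)) + (-(2*(m:ℝ)+1)) • legendreP m := by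
        push_cast
        have h := leg_b m
        rw [leg_a] at h
        rw [leg_a, h]
        module
      rw [leg_a] at hbb
      rw [hbb]
      simp only [ladd, lsmul, mul_smul_comm, smul_mul_assoc, mul_add, add_mul]
      have hne : (2 * ((m:ℝ) + 2) - 3) ≠ 0 := by
        have : (2 * ((m:ℝ) + 2) - 3) = 2 * m + 1 := by ring
        rw [this]; positivity
      have hne' : (2 * (m:ℝ) + 1) ≠ 0 := by positivity
      push_cast
      have hsc : (2 * ((m:ℝ) + 2) + 1) / (2 * ((m:ℝ) + 2) - 3) = (2 * ((m:ℝ) + 2) + 1) * (2 * (m:ℝ) + 1)⁻¹ := by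
        rw [show (2 * ((m:ℝ) + 2) - 3) = 2 * m + 1 by ring, div_eq_mul_inv]
      rw [hsc]
      match_scalars <;> field_simp <;> ring

end
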